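/- If f : ℝ² → [0,∞) has a closed and connected graph and C is a skyhook for f, then the set of discontinuity points of f intersects the bounded component B(C) of ℝ² \ C. -/

import Mathlib

open Real Filter Set

/-- The plane. -/
abbrev Plane := EuclideanSpace ℝ (Fin 2)

/-- `C` is a skyhook for `f` with infinity point `p`. -/
def IsSkyhook (f : Plane → ℝ) (C : Set Plane) (p : Plane) : Prop :=
  ∃ h : ℝ → Plane, ContinuousOn h (Icc 0 (2 * π)) ∧ InjOn h (Ico 0 (2 * π)) ∧
    h '' Icc 0 (2 * π) = C ∧ h 0 = p ∧ h (2 * π) = h 0 ∧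
    ContinuousOn (f ∘ h) (Ico 0 (2 * π)) ∧
    Tendsto (f ∘ h) (nhdsWithin (2 * π) (Iio (2 * π))) atTop


lemma sk_const_of_exp_one {X : Type*} [TopologicalSpace X] {S : Set X} (hS : IsPreconnected S)
    {k : X → ℂ} (hk : ContinuousOn k S) (h1 : ∀ z ∈ S, Complex.exp (k z) = 1)
    {x y : X} (hx : x ∈ S) (hy : y ∈ S) : k x = k y := by
  refine hS.induction₂ (fun a b => k a = k b) ?_ (fun _ _ _ _ _ _ => Eq.trans)
    (fun _ _ _ _ => Eq.symm) hx hy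
  intro a ha
  have := (hk a ha) (Metric.ball_mem_nhds (k a) one_pos)
  filter_upwards [this, self_mem_nhdsWithin] with b hb hbS
  have hb : dist (k b) (k a) < 1 := hb
  rw [dist_eq_norm] at hb
  have h2 : Complex.exp (k b - k a) = 1 := by
    rw [Complex.exp_sub, h1 _ hbS, h1 _ ha, div_one]
  obtain ⟨n, hn⟩ := Complex.exp_eq_one_iff.1 h2
  rw [hn] at hb
  have h3 : ‖(n : ℂ) * (2 * π * Complex.I)‖ = |(n:ℝ)| * (2 * π) := by
    simp [abs_of_pos Real.pi_pos]
  rw [h3] at hb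
  have hn0 : n = 0 := by
    by_contra hne
    have : (1:ℝ) ≤ |(n:ℝ)| := by exact_mod_cast Int.one_le_abs hne
    nlinarith [Real.pi_gt_three]
  rw [hn0] at hn
  have : k b = k a := by simpa [sub_eq_zero] using hn
  exact this.symm

lemma sk_log_plane (F : ℂ → ℂ) (hF : Continuous F) (h0 : ∀ z, F z ≠ 0) :
    ∃ L : C(ℂ, ℂ), ∀ z, Complex.exp (L z) = F z := by
  obtain ⟨L, ⟨-, hL⟩, -⟩ := Complex.isCoveringMapOn_exp.existsUnique_continuousMap_lifts
    (⟨F, hF⟩ : C(ℂ, ℂ)) (a₀ := 0) (Complex.exp_log (h0 0)) (fun a => by simpa using h0 a)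
  exact ⟨L, fun z => congrFun hL z⟩

lemma sk_key {U : Set ℂ} (hUb : Bornology.IsBounded U) {x : ℂ}
    (hx : x ∈ U) (F : ℂ → ℂ) (hF : Continuous F) (h0 : ∀ z ∈ U, F z ≠ 0)
    (hfr : ∀ z ∈ frontier U, F z = z - x) : False := by
  classical
  obtain ⟨L, hL⟩ := sk_log_plane (fun z => if z ∈ U then F z else z - x)
    (Continuous.if hfr hF (by fun_prop)) (by
      intro z
      by_cases hz : z ∈ U
      · simpa [hz] using h0 z hz
      · simp only [hz, if_false]
        intro h
        exact hz ((sub_eq_zero.1 h) ▸ hx))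
  obtain ⟨R, hRpos, hR⟩ := hUb.subset_ball_lt 0 x
  let k : ℝ → ℂ := fun t => L (x + R * Complex.exp (t * Complex.I)) - t * Complex.I - Real.log R
  have hk : Continuous k := by fun_prop
  have hR0 : (R:ℂ) ≠ 0 := by exact_mod_cast hRpos.ne'
  have h1 : ∀ t ∈ (univ : Set ℝ), Complex.exp (k t) = 1 := by
    intro t _
    have hn : x + R * Complex.exp (t * Complex.I) ∉ U := by
      intro h
      have := hR h
      simp [abs_of_pos hRpos, dist_eq_norm, Complex.norm_exp_ofReal_mul_I] at this
    have := hL (x + R * Complex.exp (t * Complex.I))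
    simp only [hn, if_false] at this
    simp only [k]
    rw [Complex.exp_sub, Complex.exp_sub, this, ← Complex.ofReal_exp, Real.exp_log hRpos]
    have := Complex.exp_ne_zero (t * Complex.I)
    field_simp
    ring
  have h2 := sk_const_of_exp_one isPreconnected_univ hk.continuousOn h1 (mem_univ 0)
    (mem_univ (2 * π))
  simp only [k] at h2
  push_cast at h2
  rw [Complex.exp_two_pi_mul_I] at h2
  simp only [zero_mul, Complex.exp_zero, sub_zero] at h2
  have h3 : (2 * π * Complex.I : ℂ) = 0 := by linear_combination h2
  simp [Real.pi_ne_zero] at h3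

/-- `u` has a continuous logarithm on `K`. -/
def SkLog (K : Set ℂ) (u : ℂ → ℂ) : Prop :=
  ∃ L : C(ℂ, ℂ), ∀ z ∈ K, Complex.exp (L z) = u z

lemma sk_log_of_continuousOn {K : Set ℂ} (hK : IsClosed K) {u l : ℂ → ℂ}
    (hl : ContinuousOn l K) (h : ∀ z ∈ K, Complex.exp (l z) = u z) : SkLog K u := by
  obtain ⟨L, hL⟩ := ContinuousMap.exists_restrict_eq hK
    (⟨K.domRestrict l, continuousOn_iff_continuous_domRestrict.1 hl⟩ : C(K, ℂ))
  refine ⟨L, fun z hz => ?_⟩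
  have : L z = l z := congrArg (fun g : C(K, ℂ) => g ⟨z, hz⟩) hL
  rw [this, h z hz]

lemma sk_log_union {K₁ K₂ : Set ℂ} (h₁ : IsClosed K₁) (h₂ : IsClosed K₂)
    (hc : IsPreconnected (K₁ ∩ K₂)) {u : ℂ → ℂ}
    (hu : ∀ z ∈ K₁ ∩ K₂, u z ≠ 0) (hl₁ : SkLog K₁ u) (hl₂ : SkLog K₂ u) : SkLog (K₁ ∪ K₂) u := by
  classical
  obtain ⟨L₁, hL₁⟩ := hl₁
  obtain ⟨L₂, hL₂⟩ := hl₂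
  have h1 : ∀ z ∈ K₁ ∩ K₂, Complex.exp (L₁ z - L₂ z) = 1 := fun z hz => by
    rw [Complex.exp_sub, hL₁ z hz.1, hL₂ z hz.2, div_self (hu z hz)]
  obtain ⟨c, hc1, hc2⟩ : ∃ c : ℂ, Complex.exp c = 1 ∧ ∀ z ∈ K₁ ∩ K₂, L₁ z = L₂ z + c := by
    rcases (K₁ ∩ K₂).eq_empty_or_nonempty with he | ⟨w, hw⟩
    · exact ⟨0, by simp, by simp [he]⟩
    · refine ⟨L₁ w - L₂ w, h1 w hw, fun z hz => ?_⟩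
      have := sk_const_of_exp_one hc (k := fun z => L₁ z - L₂ z) (by fun_prop) h1 hz hw
      rw [← this]; ring
  refine sk_log_of_continuousOn (h₁.union h₂) (l := fun z => if z ∈ K₁ then L₁ z else L₂ z + c)
    ?_ ?_
  · refine ContinuousOn.union_of_isClosed ?_ ?_ h₁ h₂
    · exact (L₁.continuous.continuousOn).congr fun z hz => by simp [hz]
    · refine ContinuousOn.congr (f := fun z => L₂ z + c) (by fun_prop) fun z hz => ?_
      by_cases hz1 : z ∈ K₁
      · simp [hz1, hc2 z ⟨hz1, hz⟩]
      · simp [hz1]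
  · intro z hz
    by_cases hz1 : z ∈ K₁
    · simp [hz1, hL₁ z hz1]
    · simp [hz1, Complex.exp_add, hc1, hL₂ z (hz.resolve_left hz1)]

lemma sk_log_mul {K : Set ℂ} {u v w : ℂ → ℂ} (hu : SkLog K u) (hv : SkLog K v)
    (h : ∀ z ∈ K, w z = u z * v z) : SkLog K w := by
  obtain ⟨L, hL⟩ := hu
  obtain ⟨M, hM⟩ := hv
  exact ⟨L + M, fun z hz => by simp [Complex.exp_add, hL z hz, hM z hz, h z hz]⟩

lemma sk_log_inv {K : Set ℂ} {u v : ℂ → ℂ} (hu : SkLog K u)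
    (h : ∀ z ∈ K, v z = (u z)⁻¹) : SkLog K v := by
  obtain ⟨L, hL⟩ := hu
  exact ⟨-L, fun z hz => by simp [Complex.exp_neg, hL z hz, h z hz]⟩

/-- Points in a connected set missing `K` are not separated by `K`. -/
lemma sk_log_of_connected {K B : Set ℂ} (hK : IsClosed K) (hB : IsPreconnected B)
    (hKB : Disjoint K B) {x y : ℂ} (hx : x ∈ B) (hy : y ∈ B) :
    SkLog K (fun z => (z - x) / (z - y)) := by
  have hne : ∀ z ∈ K, ∀ a ∈ B, z - a ≠ 0 := fun z hz a ha h =>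
    disjoint_left.1 hKB hz ((sub_eq_zero.1 h) ▸ ha)
  refine hB.induction₂ (fun x y => SkLog K (fun z => (z - x) / (z - y))) ?_ ?_ ?_ hx hy
  · intro a ha
    have haK : a ∈ Kᶜ := fun h => disjoint_left.1 hKB h ha
    obtain ⟨r, hr, hball⟩ := Metric.isOpen_iff.1 hK.isOpen_compl a haK
    have hev : ∀ᶠ b in nhdsWithin a B, b ∈ Metric.ball a r :=
      nhdsWithin_le_nhds (Metric.ball_mem_nhds a hr)
    filter_upwards [hev, self_mem_nhdsWithin] with b hb hbB
    -- (z - b)/(z - a) is in the slit plane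
    have hs : ∀ z ∈ K, (z - b) / (z - a) ∈ Complex.slitPlane := by
      intro z hz
      have hza : r ≤ ‖z - a‖ := by
        by_contra hlt
        exact hball (by rw [Metric.mem_ball, dist_eq_norm]; linarith) hz
      have hba : ‖a - b‖ < r := by rw [Metric.mem_ball, dist_comm, dist_eq_norm] at hb; exact hb
      have heq : (z - b) / (z - a) = 1 + (a - b) / (z - a) := by
        have := hne z hz a ha
        field_simp; ring
      rw [heq]
      apply Complex.mem_slitPlane_of_norm_lt_one
      rw [norm_div, div_lt_one (by linarith)]
      linarith
    have hlog : SkLog K (fun z => (z - b) / (z - a)) := by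
      refine sk_log_of_continuousOn hK (l := fun z => Complex.log ((z - b) / (z - a))) ?_ ?_
      · refine ContinuousOn.clog ?_ hs
        exact ContinuousOn.div (by fun_prop) (by fun_prop) (fun z hz => hne z hz a ha)
      · intro z hz
        exact Complex.exp_log (Complex.slitPlane_ne_zero (hs z hz))
    exact sk_log_inv hlog fun z _ => by simp
  · intro a b c ha hb hc h1 h2
    refine sk_log_mul h1 h2 fun z hz => ?_
    have := hne z hz b hb
    have := hne z hz c hc
    field_simp
  · intro a b ha hb h
    exact sk_log_inv h fun z _ => by simp

/-- If `K` does not separate `x` from `y` in the sense of logarithms, and the bounded open set `U`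
with frontier in `K` contains `x`, then `U` contains `y`. -/
lemma sk_sep {K U : Set ℂ} (hUb : Bornology.IsBounded U)
    (hUK : frontier U ⊆ K) {x y : ℂ} (hx : x ∈ U) (hyK : y ∉ K)
    (hl : SkLog K (fun z => (z - x) / (z - y))) : y ∈ U := by
  by_contra hy
  obtain ⟨L, hL⟩ := hl
  refine sk_key hUb hx (fun z => Complex.exp (L z) * (z - y)) (by fun_prop) ?_ ?_
  · intro z hz
    refine mul_ne_zero (Complex.exp_ne_zero _) fun h => hy ((sub_eq_zero.1 h) ▸ hz)
  · intro z hz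
    have : z - y ≠ 0 := fun h => hyK ((sub_eq_zero.1 h) ▸ hUK hz)
    simp only [hL z (hUK hz)]
    field_simp

lemma sk_subset_of_frontier {B S : Set ℂ} (hB : IsOpen B) (hS : IsPreconnected S)
    (hd : Disjoint (frontier B) S) {x : ℂ} (hx : x ∈ B) (hxS : x ∈ S) : S ⊆ B := by
  intro y hy
  by_contra hyB
  obtain ⟨z, hzS, hz1, hz2⟩ := hS B (closure B)ᶜ hB isClosed_closure.isOpen_compl
    (fun z hz => by
      by_cases h : z ∈ B
      · exact Or.inl h
      · refine Or.inr fun hc => disjoint_left.1 hd ?_ hz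
        rw [hB.frontier_eq]; exact ⟨hc, h⟩)
    ⟨x, hxS, hx⟩ ⟨y, hy, fun hc => disjoint_left.1 hd (by
      rw [hB.frontier_eq]; exact ⟨hc, hyB⟩) hy⟩
  exact hz2 (subset_closure hz1)

lemma sk_frontier_component {X : Type*} [TopologicalSpace X] [LocallyConnectedSpace X]
    {K : Set X} (hK : IsClosed K) (x : X) :
    frontier (connectedComponentIn Kᶜ x) ⊆ K := by
  intro z hz
  by_contra hzK
  have hz' : z ∈ Kᶜ := hzK
  have ho : IsOpen (connectedComponentIn Kᶜ x) := hK.isOpen_compl.connectedComponentIn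
  rw [ho.frontier_eq] at hz
  have ho' : IsOpen (connectedComponentIn Kᶜ z) := hK.isOpen_compl.connectedComponentIn
  obtain ⟨w, hw1, hw2⟩ := mem_closure_iff.1 hz.1 _ ho' (mem_connectedComponentIn hz')
  apply hz.2
  rw [connectedComponentIn_eq hw2, ← connectedComponentIn_eq hw1]
  exact mem_connectedComponentIn hz'

/-- Structure of a Jordan curve near a point. -/
def SkCurve (C : Set ℂ) : Prop :=
  IsClosed C ∧ ∀ q ∈ C, ∀ ε > 0, ∃ C₂ ⊆ C, IsClosed C₂ ∧ IsPreconnected C₂ ∧ q ∉ C₂ ∧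
    C \ C₂ ⊆ Metric.ball q ε ∧ ∀ u : ℂ → ℂ, Continuous u → (∀ z ∈ C₂, u z ≠ 0) → SkLog C₂ u

lemma sk_closure {C B : Set ℂ} (hC : SkCurve C) (hBn : B.Nonempty)
    (hBb : Bornology.IsBounded B) (hBC : Disjoint C B) (hfr : frontier B ⊆ C) : C ⊆ closure B := by
  intro q hq
  by_contra hqB
  obtain ⟨r, hr, hball⟩ := Metric.isOpen_iff.1 isClosed_closure.isOpen_compl q hqB
  obtain ⟨C₂, hC₂, -, -, -, hs, hlog⟩ := hC.2 q hq r hr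
  have hf2 : frontier B ⊆ C₂ := by
    intro z hz
    by_contra hz2
    exact hball (hs ⟨hfr hz, hz2⟩) (frontier_subset_closure hz)
  obtain ⟨b, hb⟩ := hBn
  obtain ⟨L, hL⟩ := hlog (fun z => z - b) (by fun_prop) (fun z hz h =>
    disjoint_left.1 hBC (hC₂ hz) ((sub_eq_zero.1 h) ▸ hb))
  exact sk_key hBb hb (fun z => Complex.exp (L z)) (by fun_prop)
    (fun z _ => Complex.exp_ne_zero _) (fun z hz => hL z (hf2 hz))

lemma sk_local {C B : Set ℂ} (hC : SkCurve C) (hBo : IsOpen B) (hBp : IsPreconnected B)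
    (hBC : Disjoint C B) (hfr : frontier B ⊆ C) {q : ℂ} (hq : q ∈ C) {ε : ℝ} (hε : 0 < ε) :
    ∃ δ > 0, ∀ x ∈ B ∩ Metric.ball q δ, ∀ y ∈ B ∩ Metric.ball q δ,
      ∃ S ⊆ B ∩ Metric.ball q ε, IsPreconnected S ∧ x ∈ S ∧ y ∈ S := by
  obtain ⟨C₂, hC₂, hcl, hpre, hq2, hs, -⟩ := hC.2 q hq ε hε
  obtain ⟨r, hr, hball⟩ := Metric.isOpen_iff.1 hcl.isOpen_compl q hq2
  refine ⟨min r ε, lt_min hr hε, fun x hx y hy => ?_⟩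
  have hsub : Metric.ball q (min r ε) ⊆ Metric.ball q ε := Metric.ball_subset_ball (min_le_right _ _)
  have hsub' : Metric.ball q (min r ε) ⊆ Metric.ball q r := Metric.ball_subset_ball (min_le_left _ _)
  have hsphere : ∀ z ∈ Metric.sphere q ε, z ∉ Metric.ball q ε := fun z hz hz' => by
    rw [Metric.mem_sphere] at hz; rw [Metric.mem_ball] at hz'; linarith
  have hKcl : IsClosed (C ∪ (C₂ ∪ Metric.sphere q ε)) :=
    hC.1.union (hcl.union Metric.isClosed_sphere)
  have hnot : ∀ z ∈ B ∩ Metric.ball q (min r ε), z ∉ C ∪ (C₂ ∪ Metric.sphere q ε) := by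
    rintro z ⟨hzB, hz⟩ (h | h | h)
    · exact disjoint_left.1 hBC h hzB
    · exact hball (hsub' hz) h
    · exact hsphere z h (hsub hz)
  have hxx := hnot x hx
  have hyy := hnot y hy
  have hlog : SkLog (C ∪ (C₂ ∪ Metric.sphere q ε)) (fun z => (z - x) / (z - y)) := by
    refine sk_log_union hC.1 (hcl.union Metric.isClosed_sphere) ?_ ?_ ?_ ?_
    · convert hpre using 1
      ext z
      constructor
      · rintro ⟨h1, h2 | h2⟩
        · exact h2
        · by_contra h3
          exact hsphere z h2 (hs ⟨h1, h3⟩)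
      · exact fun h => ⟨hC₂ h, Or.inl h⟩
    · intro z hz
      refine div_ne_zero ?_ ?_
      · exact fun h => hxx ((sub_eq_zero.1 h) ▸ Or.inl hz.1)
      · exact fun h => hyy ((sub_eq_zero.1 h) ▸ Or.inl hz.1)
    · exact sk_log_of_connected hC.1 hBp hBC hx.1 hy.1
    · refine sk_log_of_connected (hcl.union Metric.isClosed_sphere)
        (convex_ball q (min r ε)).isPreconnected ?_ hx.2 hy.2
      rw [disjoint_left]
      rintro z (h | h) hz
      · exact hball (hsub' hz) h
      · exact hsphere z h (hsub hz)
  set K := C ∪ (C₂ ∪ Metric.sphere q ε) with hK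
  have hSpre : IsPreconnected (connectedComponentIn Kᶜ x) := isPreconnected_connectedComponentIn
  have hSK : connectedComponentIn Kᶜ x ⊆ Kᶜ := connectedComponentIn_subset _ _
  have hxS : x ∈ connectedComponentIn Kᶜ x := mem_connectedComponentIn hxx
  have hSball : connectedComponentIn Kᶜ x ⊆ Metric.ball q ε := by
    refine sk_subset_of_frontier Metric.isOpen_ball hSpre ?_ (hsub hx.2) hxS
    rw [frontier_ball q hε.ne', disjoint_left]
    exact fun z hz hzS => hSK hzS (Or.inr (Or.inr hz))
  have hSB : connectedComponentIn Kᶜ x ⊆ B := by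
    refine sk_subset_of_frontier hBo hSpre ?_ hx.1 hxS
    rw [disjoint_left]
    exact fun z hz hzS => hSK hzS (Or.inl (hfr hz))
  exact ⟨_, fun z hz => ⟨hSB hz, hSball hz⟩, hSpre, hxS,
    sk_sep (Metric.isBounded_ball.subset hSball) (sk_frontier_component hKcl x) hxS hyy hlog⟩

lemma sk_curve {h : ℝ → ℂ} (hc : ContinuousOn h (Icc 0 (2 * π))) (hinj : InjOn h (Ico 0 (2 * π)))
    (hper : h (2 * π) = h 0) : SkCurve (h '' Icc 0 (2 * π)) := by
  have : Fact (0 < 2 * π) := ⟨Real.two_pi_pos⟩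
  have hpi := Real.pi_pos
  let g : AddCircle (2 * π) → ℂ := AddCircle.liftIco (2 * π) 0 h
  have hg : Continuous g := AddCircle.liftIco_zero_continuous hper.symm hc
  have hgv : ∀ t ∈ Ico 0 (2 * π), g (t : AddCircle (2 * π)) = h t := fun t ht =>
    AddCircle.liftIco_zero_coe_apply ht
  have hrep : ∀ s : ℝ, ∀ a : AddCircle (2 * π), ∃ t ∈ Ico s (s + 2 * π), (t : AddCircle (2 * π)) = a := by
    intro s a
    have : a ∈ ((↑) : ℝ → AddCircle (2 * π)) '' Ico s (s + 2 * π) := by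
      rw [AddCircle.coe_image_Ico_eq]; trivial
    exact this
  have hginj : Function.Injective g := by
    intro a b hab
    obtain ⟨s, hs, rfl⟩ := hrep 0 a
    obtain ⟨t, ht, rfl⟩ := hrep 0 b
    rw [zero_add] at hs ht
    rw [hgv s hs, hgv t ht] at hab
    rw [hinj hs ht hab]
  have hrange : h '' Icc 0 (2 * π) = range g := by
    ext z
    constructor
    · rintro ⟨t, ht, rfl⟩
      rcases eq_or_lt_of_le ht.2 with h2 | h2
      · exact ⟨((0 : ℝ) : AddCircle (2 * π)), by rw [hgv 0 ⟨le_rfl, by linarith⟩, h2, hper]⟩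
      · exact ⟨t, hgv t ⟨ht.1, h2⟩⟩
    · rintro ⟨a, rfl⟩
      obtain ⟨s, hs, rfl⟩ := hrep 0 a
      rw [zero_add] at hs
      exact ⟨s, ⟨hs.1, hs.2.le⟩, (hgv s hs).symm⟩
  let H : ℝ → ℂ := fun t => g (t : AddCircle (2 * π))
  have hH : Continuous H := hg.comp (AddCircle.continuous_mk' _)
  have hHinj : ∀ a : ℝ, InjOn H (Ico a (a + 2 * π)) := fun a s hs t ht hst =>
    (AddCircle.coe_eq_coe_iff_of_mem_Ico hs ht).1 (hginj hst)
  rw [hrange]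
  refine ⟨(isCompact_range hg).isClosed, ?_⟩
  rintro _ ⟨a, rfl⟩ ε hε
  obtain ⟨φ, -, rfl⟩ := hrep 0 a
  obtain ⟨η₀, hη₀, hball⟩ := Metric.continuous_iff.1 hH φ ε hε
  obtain ⟨η, hη, hη1, hη2⟩ : ∃ η > 0, η < η₀ ∧ η < π :=
    ⟨min η₀ π / 2, by positivity, by linarith [min_le_left η₀ π, lt_min hη₀ hpi],
      by linarith [min_le_right η₀ π, lt_min hη₀ hpi]⟩
  have hsub : Icc (φ + η) (φ + 2 * π - η) ⊆ Ico φ (φ + 2 * π) := fun t ht =>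
    ⟨by linarith [ht.1], by linarith [ht.2]⟩
  have hle : φ + η ≤ φ + 2 * π - η := by linarith
  refine ⟨H '' Icc (φ + η) (φ + 2 * π - η), ?_, (isCompact_Icc.image hH).isClosed,
    isPreconnected_Icc.image H hH.continuousOn, ?_, ?_, ?_⟩
  · rintro _ ⟨t, -, rfl⟩
    exact ⟨_, rfl⟩
  · rintro ⟨t, ht, hte⟩
    have := hHinj φ (hsub ht) ⟨le_rfl, by linarith⟩ hte
    linarith [ht.1]
  · rintro _ ⟨⟨a, rfl⟩, h2⟩
    obtain ⟨t, ht, rfl⟩ := hrep (φ - η) a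
    apply hball
    rw [Real.dist_eq, abs_lt]
    have : t < φ + η := by
      by_contra hcon
      exact h2 ⟨t, ⟨not_lt.1 hcon, by linarith [ht.2]⟩, rfl⟩
    constructor <;> linarith [ht.1]
  · intro u hu hu0
    obtain ⟨l, hl⟩ := sk_log_plane
      (fun z => u (H (projIcc (φ + η) (φ + 2 * π - η) hle z.re)))
      (by
        have : Continuous fun z : ℂ => ((projIcc (φ + η) (φ + 2 * π - η) hle z.re : ℝ)) :=
          continuous_subtype_val.comp (continuous_projIcc.comp Complex.continuous_re)
        exact hu.comp (hH.comp this))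
      (fun z => hu0 _ ⟨_, (projIcc (φ + η) (φ + 2 * π - η) hle z.re).2, rfl⟩)
    let e : Icc (φ + η) (φ + 2 * π - η) → ℂ := fun t => H t
    have he : Continuous e := hH.comp continuous_subtype_val
    have hei : Function.Injective e := fun s t hst =>
      Subtype.ext (hHinj φ (hsub s.2) (hsub t.2) hst)
    obtain ⟨L, hL⟩ := ContinuousMap.exists_extension' (he.isClosedEmbedding hei)
      (⟨fun t => l ((t : ℝ) : ℂ), by fun_prop⟩ : C(Icc (φ + η) (φ + 2 * π - η), ℂ))
    refine ⟨L, ?_⟩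
    rintro _ ⟨t, ht, rfl⟩
    have h1 : L (H t) = l (t : ℂ) := congrFun hL ⟨t, ht⟩
    rw [h1, hl]
    simp [projIcc_of_mem hle ht]

lemma sk_preimage_closed {f : ℂ → ℝ} (hclosed : IsClosed {p : ℂ × ℝ | p.2 = f p.1}) {T : Set ℝ}
    (hT : IsCompact T) : IsClosed (f ⁻¹' T) := by
  have : CompactSpace T := isCompact_iff_compactSpace.1 hT
  have h1 : IsClosed {p : ℂ × T | (p.2 : ℝ) = f p.1} :=
    hclosed.preimage (f := fun p : ℂ × T => (p.1, (p.2 : ℝ))) (by fun_prop)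
  have h2 := isClosedMap_fst_of_compactSpace _ h1
  convert h2 using 1
  ext x
  constructor
  · intro hx
    exact ⟨(x, ⟨f x, hx⟩), rfl, rfl⟩
  · rintro ⟨⟨y, t⟩, hy, rfl⟩
    have hy : (t : ℝ) = f y := hy
    change f y ∈ T
    rw [← hy]
    exact t.2

lemma sk_dich {f : ℂ → ℝ} (hn : ∀ x, 0 ≤ f x)
    (hclosed : IsClosed {p : ℂ × ℝ | p.2 = f p.1}) (q : ℂ) (N : ℝ) :
    ∃ δ > 0, ∀ x ∈ Metric.ball q δ, |f x - f q| < 1 ∨ N < f x := by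
  have hT : IsCompact (Icc 0 N ∩ {t : ℝ | 1 ≤ |t - f q|}) :=
    isCompact_Icc.inter_right (isClosed_le (by fun_prop) (by fun_prop))
  have hcl := sk_preimage_closed hclosed hT
  have hq : q ∈ (f ⁻¹' (Icc 0 N ∩ {t : ℝ | 1 ≤ |t - f q|}))ᶜ := by
    intro h
    have h2 : 1 ≤ |f q - f q| := h.2
    norm_num at h2
  obtain ⟨δ, hδ, hb⟩ := Metric.isOpen_iff.1 hcl.isOpen_compl q hq
  refine ⟨δ, hδ, fun x hx => ?_⟩
  by_contra hcon
  push Not at hcon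
  exact hb hx ⟨⟨hn x, hcon.2⟩, hcon.1⟩

theorem sk_main {f : ℂ → ℝ} (hn : ∀ x, 0 ≤ f x)
    (hclosed : IsClosed {p : ℂ × ℝ | p.2 = f p.1})
    (hconn : IsPreconnected {p : ℂ × ℝ | p.2 = f p.1})
    {h : ℝ → ℂ} (hc : ContinuousOn h (Icc 0 (2 * π))) (hinj : InjOn h (Ico 0 (2 * π)))
    (hper : h (2 * π) = h 0) (hfc : ContinuousOn (f ∘ h) (Ico 0 (2 * π)))
    (hft : Tendsto (f ∘ h) (nhdsWithin (2 * π) (Iio (2 * π))) atTop)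
    {B : Set ℂ} (hBo : IsOpen B) (hBp : IsPreconnected B) (hBn : B.Nonempty)
    (hBb : Bornology.IsBounded B) (hBC : Disjoint (h '' Icc 0 (2 * π)) B)
    (hfr : frontier B ⊆ h '' Icc 0 (2 * π)) (hcont : ∀ x ∈ B, ContinuousAt f x) : False := by
  have hpi := Real.pi_pos
  have hC := sk_curve hc hinj hper
  have hcl := sk_closure hC hBn hBb hBC hfr
  set C := h '' Icc 0 (2 * π) with hCdef
  have hcon : ContinuousOn f B := fun x hx => (hcont x hx).continuousWithinAt
  have hnear : ∀ q ∈ C, ∀ δ > 0, ∃ x ∈ B, x ∈ Metric.ball q δ := by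
    intro q hq δ hδ
    obtain ⟨x, hx, hd⟩ := Metric.mem_closure_iff.1 (hcl hq) δ hδ
    exact ⟨x, hx, by rw [Metric.mem_ball, dist_comm]; exact hd⟩
  let A : ℂ → Prop := fun q => ∃ δ > 0, ∀ x ∈ B ∩ Metric.ball q δ, |f x - f q| < 1
  -- uniform dichotomy
  have hdich : ∀ q ∈ C, ¬ A q → ∀ N, ∃ δ > 0, ∀ x ∈ B ∩ Metric.ball q δ, N < f x := by
    intro q hq hA N
    obtain ⟨ε, hε, hd⟩ := sk_dich hn hclosed q (max N (f q + 1))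
    obtain ⟨δ, hδ, hS⟩ := sk_local hC hBo hBp hBC hfr hq hε
    have hδε : ∀ x ∈ B ∩ Metric.ball q δ, x ∈ Metric.ball q ε := fun x hx => by
      obtain ⟨S, hSs, -, hxS, -⟩ := hS x hx x hx
      exact (hSs hxS).2
    refine ⟨δ, hδ, fun x hx => ?_⟩
    rcases hd x (hδε x hx) with h1 | h1
    · exfalso
      apply hA
      refine ⟨δ, hδ, fun y hy => ?_⟩
      rcases hd y (hδε y hy) with h2 | h2
      · exact h2
      · exfalso
        obtain ⟨S, hSs, hSp, hxS, hyS⟩ := hS x hx y hy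
        have hfS : ContinuousOn f S := hcon.mono fun z hz => (hSs hz).1
        have hiv := hSp.intermediate_value hxS hyS hfS
        have : max N (f q + 1) ∈ Icc (f x) (f y) :=
          ⟨by linarith [(abs_lt.1 h1).2, le_max_right N (f q + 1)], h2.le⟩
        obtain ⟨z, hz, hzf⟩ := hiv this
        rcases hd z (hSs hz).2 with h3 | h3
        · linarith [(abs_lt.1 h3).2, le_max_right N (f q + 1)]
        · linarith
    · exact lt_of_le_of_lt (le_max_left _ _) h1
  have hmem : ∀ t ∈ Ico 0 (2 * π), h t ∈ C := fun t ht => ⟨t, ⟨ht.1, ht.2.le⟩, rfl⟩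
  have hsubball : ∀ (q : ℂ) (δ : ℝ), ∀ q' ∈ Metric.ball q δ, ∃ δ' > 0,
      Metric.ball q' δ' ⊆ Metric.ball q δ := fun q δ q' hq' =>
    Metric.isOpen_iff.1 Metric.isOpen_ball q' hq'
  have hA : ∀ s ∈ Ico 0 (2 * π), ∀ t ∈ Ico 0 (2 * π), (A (h s) ↔ A (h t)) := by
    intro s hs t ht
    refine isPreconnected_Ico.induction₂ (fun s t => (A (h s) ↔ A (h t))) ?_
      (fun _ _ _ _ _ _ => Iff.trans) (fun _ _ _ _ => Iff.symm) hs ht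
    intro a ha
    have hca : ContinuousWithinAt h (Ico 0 (2 * π)) a :=
      (hc a ⟨ha.1, ha.2.le⟩).mono Ico_subset_Icc_self
    by_cases hAa : A (h a)
    · obtain ⟨δ, hδ, hb⟩ := hAa
      filter_upwards [hca (Metric.ball_mem_nhds _ hδ), self_mem_nhdsWithin] with b hb1 hb2
      refine iff_of_true ⟨δ, hδ, hb⟩ ?_
      by_contra hnA
      obtain ⟨δ₁, hδ₁, h1⟩ := hdich _ (hmem b hb2) hnA (f (h a) + 1)
      obtain ⟨δ₂, hδ₂, h2⟩ := hsubball _ _ _ hb1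
      obtain ⟨x, hxB, hx⟩ := hnear _ (hmem b hb2) (min δ₁ δ₂) (lt_min hδ₁ hδ₂)
      have h3 := h1 x ⟨hxB, Metric.ball_subset_ball (min_le_left _ _) hx⟩
      have h4 := hb x ⟨hxB, h2 (Metric.ball_subset_ball (min_le_right _ _) hx)⟩
      linarith [(abs_lt.1 h4).2]
    · obtain ⟨δ, hδ, hb⟩ := hdich _ (hmem a ha) hAa (f (h a) + 3)
      filter_upwards [hca (Metric.ball_mem_nhds _ hδ),
        hfc a ha (Metric.ball_mem_nhds _ one_pos), self_mem_nhdsWithin] with b hb1 hb3 hb2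
      refine iff_of_false hAa ?_
      rintro ⟨δ₁, hδ₁, h1⟩
      obtain ⟨δ₂, hδ₂, h2⟩ := hsubball _ _ _ hb1
      obtain ⟨x, hxB, hx⟩ := hnear _ (hmem b hb2) (min δ₁ δ₂) (lt_min hδ₁ hδ₂)
      have h3 := h1 x ⟨hxB, Metric.ball_subset_ball (min_le_left _ _) hx⟩
      have h4 := hb x ⟨hxB, h2 (Metric.ball_subset_ball (min_le_right _ _) hx)⟩
      have h5 : |f (h b) - f (h a)| < 1 := hb3
      linarith [(abs_lt.1 h3).2, (abs_lt.1 h5).2]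
  have h0 : (0 : ℝ) ∈ Ico 0 (2 * π) := ⟨le_rfl, by linarith⟩
  by_cases hA0 : A (h 0)
  · obtain ⟨δ, hδ, hb⟩ := id hA0
    have hce : ContinuousWithinAt h (Icc 0 (2 * π)) (2 * π) := hc _ ⟨by linarith, le_rfl⟩
    have hce' : Tendsto h (nhdsWithin (2 * π) (Iio (2 * π))) (nhds (h 0)) := by
      rw [← hper]
      refine Tendsto.mono_left hce ?_
      rw [← nhdsWithin_Ico_eq_nhdsLT (show (0:ℝ) < 2 * π by linarith)]
      exact nhdsWithin_mono _ Ico_subset_Icc_self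
    have hI : ∀ᶠ t in nhdsWithin (2 * π) (Iio (2 * π)), t ∈ Ico 0 (2 * π) :=
      Ico_mem_nhdsLT (by linarith)
    obtain ⟨b, hb1, hb3, hb2⟩ := ((hce'.eventually (Metric.ball_mem_nhds _ hδ)).and
      ((hft.eventually_gt_atTop (f (h 0) + 3)).and hI)).exists
    have hb1 : h b ∈ Metric.ball (h 0) δ := hb1
    have hb3 : f (h 0) + 3 < f (h b) := hb3
    obtain ⟨δ₁, hδ₁, h1⟩ := (hA 0 h0 b hb2).1 hA0
    obtain ⟨δ₂, hδ₂, h2⟩ := hsubball _ _ _ hb1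
    obtain ⟨x, hxB, hx⟩ := hnear _ (hmem b hb2) (min δ₁ δ₂) (lt_min hδ₁ hδ₂)
    have h3 := h1 x ⟨hxB, Metric.ball_subset_ball (min_le_left _ _) hx⟩
    have h4 := hb x ⟨hxB, h2 (Metric.ball_subset_ball (min_le_right _ _) hx)⟩
    linarith [(abs_lt.1 h3).1, (abs_lt.1 h4).2]
  · have hall : ∀ q ∈ C, ¬ A q := by
      rintro _ ⟨t, ht, rfl⟩
      rcases eq_or_lt_of_le ht.2 with h2 | h2
      · rw [h2, hper]; exact hA0
      · exact fun hAt => hA0 ((hA 0 h0 t ⟨ht.1, h2⟩).2 hAt)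
    let G : Set (ℂ × ℝ) := {p | p.1 ∈ B ∧ p.2 = f p.1}
    have hout : ∀ x, x ∉ B → (x, f x) ∉ closure G := by
      intro x hx hxG
      by_cases hxc : x ∈ closure B
      · have hxC : x ∈ C := hfr (by rw [hBo.frontier_eq]; exact ⟨hxc, hx⟩)
        obtain ⟨δ, hδ, hb⟩ := hdich x hxC (hall x hxC) (f x + 1)
        obtain ⟨⟨y, t⟩, ⟨hy1, hy2⟩, hyB, hyt⟩ := mem_closure_iff.1 hxG
          (Metric.ball x δ ×ˢ Iio (f x + 1)) (Metric.isOpen_ball.prod isOpen_Iio)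
          ⟨Metric.mem_ball_self hδ, by simp⟩
        have h1 := hb y ⟨hyB, hy1⟩
        have hyt : t = f y := hyt
        have hy2 : t < f x + 1 := hy2
        linarith
      · obtain ⟨⟨y, t⟩, ⟨hy1, hy2⟩, hyB, hyt⟩ := mem_closure_iff.1 hxG
          ((closure B)ᶜ ×ˢ univ) (isClosed_closure.isOpen_compl.prod isOpen_univ)
          ⟨hxc, trivial⟩
        exact hy1 (subset_closure hyB)
    obtain ⟨b, hb⟩ := hBn
    obtain ⟨⟨y, t⟩, hyt, hy1, hy2⟩ := hconn (Prod.fst ⁻¹' B) (closure G)ᶜ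
      (hBo.preimage continuous_fst) isClosed_closure.isOpen_compl
      (by
        rintro ⟨y, t⟩ hyt
        have hyt : t = f y := hyt
        subst hyt
        by_cases hy : y ∈ B
        · exact Or.inl hy
        · exact Or.inr (hout y hy))
      ⟨(b, f b), rfl, hb⟩
      ⟨(h 0, f (h 0)), rfl, hout _ fun hB => disjoint_left.1 hBC (hmem 0 h0) hB⟩
    exact hy2 (subset_closure ⟨hy1, hyt⟩)

theorem skyhook_forces_discontinuity_inside
    (f : Plane → ℝ) (hnonneg : ∀ x, 0 ≤ f x)
    (hclosed : IsClosed {p : Plane × ℝ | p.2 = f p.1})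
    (hconn : IsConnected {p : Plane × ℝ | p.2 = f p.1})
    (C : Set Plane) (p : Plane) (hC : IsSkyhook f C p)
    (B : Set Plane)
    (hBcomp : ∃ x ∈ Cᶜ, B = connectedComponentIn Cᶜ x)
    (hBbd : Bornology.IsBounded B) :
    ∃ x ∈ B, ¬ ContinuousAt f x := by
  by_contra hcon
  push Not at hcon
  obtain ⟨h, hc, hinj, hCeq, -, hper, hfc, hft⟩ := hC
  obtain ⟨x₀, hx₀, hBeq⟩ := hBcomp
  have hCcl : IsClosed C := by
    rw [← hCeq]
    exact (isCompact_Icc.image_of_continuousOn hc).isClosed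
  have hBo : IsOpen B := by rw [hBeq]; exact hCcl.isOpen_compl.connectedComponentIn
  have hBp : IsPreconnected B := by rw [hBeq]; exact isPreconnected_connectedComponentIn
  have hBn : B.Nonempty := ⟨x₀, by rw [hBeq]; exact mem_connectedComponentIn hx₀⟩
  have hBC : B ⊆ Cᶜ := by rw [hBeq]; exact connectedComponentIn_subset _ _
  have hfr : frontier B ⊆ C := by rw [hBeq]; exact sk_frontier_component hCcl x₀
  let e : ℂ ≃ₗᵢ[ℝ] Plane := Complex.orthonormalBasisOneI.repr
  have he : Continuous e := e.continuous
  have hes : Continuous e.symm := e.symm.continuous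
  have himg : e.symm '' B = e ⁻¹' B := by
    ext z
    constructor
    · rintro ⟨w, hw, rfl⟩
      simpa using hw
    · intro hz
      exact ⟨e z, hz, by simp⟩
  have hfh : (f ∘ e) ∘ (e.symm ∘ h) = f ∘ h := by
    funext t; simp
  have hCimg : ∀ z, e z ∈ C → z ∈ (e.symm ∘ h) '' Icc 0 (2 * π) := by
    intro z hz
    rw [← hCeq] at hz
    obtain ⟨t, ht, hte⟩ := hz
    exact ⟨t, ht, by simp [hte]⟩
  refine sk_main (f := f ∘ e) (h := e.symm ∘ h) (B := e ⁻¹' B) (fun x => hnonneg _) ?_ ?_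
    (hes.comp_continuousOn hc) (fun s hs t ht hst => hinj hs ht (e.symm.injective hst))
    (by simp [hper]) (by rw [hfh]; exact hfc) (by rw [hfh]; exact hft)
    (hBo.preimage he) ?_ ?_ ?_ ?_ ?_ ?_
  · exact hclosed.preimage (f := fun p : ℂ × ℝ => (e p.1, p.2)) (by fun_prop)
  · have h1 := hconn.isPreconnected.image (fun p : Plane × ℝ => (e.symm p.1, p.2))
      (by fun_prop)
    convert h1 using 1
    ext ⟨z, t⟩
    constructor
    · intro hz
      exact ⟨(e z, t), hz, by simp⟩
    · rintro ⟨⟨w, s⟩, hw, hws⟩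
      have hw : s = f w := hw
      obtain ⟨rfl, rfl⟩ := Prod.mk.inj hws
      simpa using hw
  · rw [← himg]
    exact hBp.image _ hes.continuousOn
  · rw [← himg]
    exact hBn.image _
  · rw [← himg]
    exact e.symm.lipschitz.isBounded_image hBbd
  · rw [disjoint_left]
    rintro _ ⟨t, ht, rfl⟩ hB
    have hB : e (e.symm (h t)) ∈ B := hB
    rw [e.apply_symm_apply] at hB
    exact hBC hB (hCeq ▸ ⟨t, ht, rfl⟩)
  · intro z hz
    have h1 : frontier (e ⁻¹' B) = e ⁻¹' frontier B := (e.toHomeomorph.preimage_frontier B).symm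
    rw [h1] at hz
    exact hCimg z (hfr hz)
  · intro x hx
    exact ContinuousAt.comp (hcon (e x) hx) he.continuousAt
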